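/- Let a, c ∈ ℂ^M and b, d ∈ ℂ^N. Let C_T ∈ ℂ^{M×M} be the symmetric Toeplitz matrix with entries (C_T)_{p,q} = c_{|p−q|} and C_R ∈ ℂ^{N×N} the symmetric Toeplitz matrix with entries (C_R)_{p,q} = d_{|p−q|}. Define Q_a = Q_{a1} + Q_{a2} ∈ ℂ^{M×M} by [Q_{a1}]_{p,q} = a_{p+q} if p+q ≤ M−1 and 0 otherwise, [Q_{a2}]_{p,q} = a_{p−q} if p ≥ q ≥ 1 and 0 otherwise, and define Q_b = Q_{b1} + Q_{b2} ∈ ℂ^{N×N} analogously from b. Then (C_R b) ⊗ (C_T a) = (Q_b ⊗ Q_a)(d ⊗ c). -/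

import Mathlib

open Matrix Kronecker

theorem toeplitz_swap_aux (M : ℕ) (a c : Fin M → ℂ)
    (CT Q1 Q2 : Matrix (Fin M) (Fin M) ℂ)
    (hCT : ∀ p q : Fin M,
      CT p q = c ⟨p.val - q.val + (q.val - p.val), by have := p.isLt; have := q.isLt; omega⟩)
    (hQ1 : ∀ p q : Fin M, (h : p.val + q.val ≤ M - 1) →
      Q1 p q = a ⟨p.val + q.val, by have := p.isLt; omega⟩)
    (hQ1' : ∀ p q : Fin M, ¬ p.val + q.val ≤ M - 1 → Q1 p q = 0)
    (hQ2 : ∀ p q : Fin M, (h : 1 ≤ q.val ∧ q.val ≤ p.val) →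
      Q2 p q = a ⟨p.val - q.val, by have := p.isLt; omega⟩)
    (hQ2' : ∀ p q : Fin M, ¬ (1 ≤ q.val ∧ q.val ≤ p.val) → Q2 p q = 0) (p : Fin M) :
    CT.mulVec a p = (Q1 + Q2).mulVec c p := by
  have h1 : ∀ k : Fin M, Q1 p k = ∑ q : Fin M, if q.val = p.val + k.val then a q else 0 := by
    intro k
    by_cases h : p.val + k.val ≤ M - 1
    · rw [hQ1 p k h, Finset.sum_eq_single ⟨p.val + k.val, by have := p.isLt; omega⟩]
      · simp
      · intro q _ hq
        rw [if_neg]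
        exact fun e => hq (Fin.ext e)
      · simp
    · rw [hQ1' p k h, Finset.sum_eq_zero]
      intro q _
      rw [if_neg]
      have := q.isLt
      omega
  have h2 : ∀ k : Fin M, Q2 p k =
      ∑ q : Fin M, if 1 ≤ k.val ∧ q.val + k.val = p.val then a q else 0 := by
    intro k
    by_cases h : 1 ≤ k.val ∧ k.val ≤ p.val
    · rw [hQ2 p k h, Finset.sum_eq_single ⟨p.val - k.val, by have := p.isLt; omega⟩]
      · rw [if_pos]
        exact ⟨h.1, Nat.sub_add_cancel h.2⟩
      · intro q _ hq
        rw [if_neg]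
        rintro ⟨_, e⟩
        exact hq (Fin.ext (by simp only; omega))
      · simp
    · rw [hQ2' p k h, Finset.sum_eq_zero]
      intro q _
      rw [if_neg]
      omega
  simp only [Matrix.mulVec, dotProduct, Matrix.add_apply, h1, h2, ← Finset.sum_add_distrib,
    Finset.sum_mul]
  rw [Finset.sum_comm]
  refine Finset.sum_congr rfl fun q _ => ?_
  rw [hCT, Finset.sum_eq_single
    ⟨p.val - q.val + (q.val - p.val), by have := p.isLt; have := q.isLt; omega⟩]
  · rw [mul_comm]
    congr 1
    simp only
    by_cases h : p.val ≤ q.val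
    · rw [if_pos (by omega), if_neg (by omega), add_zero]
    · rw [if_neg (by omega), if_pos (by omega), zero_add]
  · intro k _ hk
    have hk' : k.val ≠ p.val - q.val + (q.val - p.val) := fun e => hk (Fin.ext e)
    rw [if_neg (by omega), if_neg (by omega)]
    simp
  · simp

/-- `(C_R b) ⊗ (C_T a) = (Q_b ⊗ Q_a)(d ⊗ c)` where `C_T, C_R` are symmetric Toeplitz
matrices generated by `c` resp. `d`, and `Q_a = Q_{a1}+Q_{a2}`, `Q_b = Q_{b1}+Q_{b2}`
are built from `a` resp. `b`. -/
theorem kron_toeplitz_mulVec_swap (M N : ℕ) (hM : 1 ≤ M) (hN : 1 ≤ N)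
    (a c : Fin M → ℂ) (b d : Fin N → ℂ)
    (CT : Matrix (Fin M) (Fin M) ℂ) (CR : Matrix (Fin N) (Fin N) ℂ)
    (Qa1 Qa2 : Matrix (Fin M) (Fin M) ℂ) (Qb1 Qb2 : Matrix (Fin N) (Fin N) ℂ)
    (hCT : ∀ p q : Fin M,
      CT p q = c ⟨p.val - q.val + (q.val - p.val), by have := p.isLt; have := q.isLt; omega⟩)
    (hCR : ∀ p q : Fin N,
      CR p q = d ⟨p.val - q.val + (q.val - p.val), by have := p.isLt; have := q.isLt; omega⟩)
    (hQa1 : ∀ p q : Fin M, (h : p.val + q.val ≤ M - 1) →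
      Qa1 p q = a ⟨p.val + q.val, by omega⟩)
    (hQa1' : ∀ p q : Fin M, ¬ p.val + q.val ≤ M - 1 → Qa1 p q = 0)
    (hQa2 : ∀ p q : Fin M, (h : 1 ≤ q.val ∧ q.val ≤ p.val) →
      Qa2 p q = a ⟨p.val - q.val, by have := p.isLt; omega⟩)
    (hQa2' : ∀ p q : Fin M, ¬ (1 ≤ q.val ∧ q.val ≤ p.val) → Qa2 p q = 0)
    (hQb1 : ∀ p q : Fin N, (h : p.val + q.val ≤ N - 1) →
      Qb1 p q = b ⟨p.val + q.val, by omega⟩)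
    (hQb1' : ∀ p q : Fin N, ¬ p.val + q.val ≤ N - 1 → Qb1 p q = 0)
    (hQb2 : ∀ p q : Fin N, (h : 1 ≤ q.val ∧ q.val ≤ p.val) →
      Qb2 p q = b ⟨p.val - q.val, by have := p.isLt; omega⟩)
    (hQb2' : ∀ p q : Fin N, ¬ (1 ≤ q.val ∧ q.val ≤ p.val) → Qb2 p q = 0) :
    (fun i : Fin N × Fin M => CR.mulVec b i.1 * CT.mulVec a i.2)
      = ((Qb1 + Qb2) ⊗ₖ (Qa1 + Qa2)).mulVec (fun i : Fin N × Fin M => d i.1 * c i.2) := by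
  funext i
  have hb := toeplitz_swap_aux N b d CR Qb1 Qb2 hCR hQb1 hQb1' hQb2 hQb2' i.1
  have ha := toeplitz_swap_aux M a c CT Qa1 Qa2 hCT hQa1 hQa1' hQa2 hQa2' i.2
  simp only [hb, ha]
  simp only [Matrix.mulVec, dotProduct, Matrix.kroneckerMap_apply, Fintype.sum_prod_type,
    Finset.sum_mul_sum]
  exact Finset.sum_congr rfl fun x _ => Finset.sum_congr rfl fun y _ => by ring
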